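/- arXiv:1703.01247 — 2 statements merged into one kernel-verified Lean document; each statement's English description precedes it below -/
import Mathlib

section
/- Let Ω be an open subset of ℂ^N, let f : Ω → ℂ^n be holomorphic, and let K ⊆ Ω be compact. If the complex derivative of f vanishes at every point of K, i.e. fderiv ℂ f y = 0 for all y ∈ K, then the image f(K) is a finite set. -/
open Filter Topology Metric

/-- Quantitative second-order Taylor bound for a bounded holomorphic function on a disc. -/
lemma norm_sub_sub_mul_deriv_le {φ : ℂ → ℂ} {R M : ℝ} (hφ : DifferentiableOn ℂ φ (ball 0 R))
    (hM : ∀ s ∈ ball (0 : ℂ) R, ‖φ s‖ ≤ M) {s : ℂ} (hs : s ∈ ball (0 : ℂ) R) :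
    ‖φ s - φ 0 - s * deriv φ 0‖ ≤ 4 * M / R ^ 2 * ‖s‖ ^ 2 := by
  have hR : 0 < R := pos_of_mem_ball hs
  have h0 : (0 : ℂ) ∈ ball (0 : ℂ) R := mem_ball_self hR
  have hnhds : ball (0 : ℂ) R ∈ 𝓝 (0 : ℂ) := ball_mem_nhds _ hR
  have h1 : ∀ z ∈ ball (0 : ℂ) R, ‖dslope φ 0 z‖ ≤ 2 * M / R := fun z hz =>
    Complex.norm_dslope_le_div_of_mapsTo_ball hφ (fun w hw => by
      rw [mem_closedBall, dist_eq_norm]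
      linarith [norm_sub_le (φ w) (φ 0), hM w hw, hM 0 h0]) hz
  have h2 : ‖dslope (dslope φ 0) 0 s‖ ≤ 2 * (2 * M / R) / R :=
    Complex.norm_dslope_le_div_of_mapsTo_ball
      ((Complex.differentiableOn_dslope hnhds).2 hφ) (fun w hw => by
      rw [mem_closedBall, dist_eq_norm]
      linarith [norm_sub_le (dslope φ 0 w) (dslope φ 0 0), h1 w hw, h1 0 h0]) hs
  have e1 := sub_smul_dslope φ 0 s
  have e2 := sub_smul_dslope (dslope φ 0) 0 s
  rw [dslope_same] at e2
  simp only [sub_zero, smul_eq_mul] at e1 e2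
  have e3 : φ s - φ 0 - s * deriv φ 0 = s ^ 2 * dslope (dslope φ 0) 0 s := by
    rw [← e1, pow_two, mul_assoc, e2]; ring
  rw [e3, norm_mul, norm_pow]
  calc ‖s‖ ^ 2 * _ ≤ ‖s‖ ^ 2 * (2 * (2 * M / R) / R) := by gcongr
    _ = _ := by field_simp; ring

/-- A bounded map into a Banach space which is holomorphic when tested against a norm-determining
family of functionals is holomorphic. -/
lemma differentiableAt_of_forall_differentiableOn {E B ι : Type*} [NormedAddCommGroup E]
    [NormedSpace ℂ E] [FiniteDimensional ℂ E] [NormedAddCommGroup B] [NormedSpace ℂ B]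
    [CompleteSpace B] (ev : ι → B →L[ℂ] ℂ)
    (hev : ∀ (b : B) (C : ℝ), 0 ≤ C → (∀ i, ‖ev i b‖ ≤ C) → ‖b‖ ≤ C)
    {F : E → B} {x : E} {r M : ℝ} (hr : 0 < r)
    (hF : ∀ i, DifferentiableOn ℂ (fun y => ev i (F y)) (ball x r))
    (hM : ∀ i, ∀ y ∈ ball x r, ‖ev i (F y)‖ ≤ M) :
    DifferentiableAt ℂ F x := by
  classical
  rcases isEmpty_or_nonempty ι with hι | ⟨⟨i₀⟩⟩
  · have : F = fun _ => 0 := funext fun y =>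
      norm_le_zero_iff.1 (hev _ 0 le_rfl fun i => (hι.false i).elim)
    rw [this]; exact differentiableAt_const _
  have hM0 : 0 ≤ M := (norm_nonneg _).trans (hM i₀ x (mem_ball_self hr))
  have hext : ∀ b b' : B, (∀ i, ev i b = ev i b') → b = b' := fun b b' h =>
    sub_eq_zero.1 (norm_le_zero_iff.1 (hev _ 0 le_rfl fun i => by simp [h i]))
  let D : ι → E →L[ℂ] ℂ := fun i => fderiv ℂ (fun y => ev i (F y)) x
  have hD : ∀ i, HasFDerivAt (fun y => ev i (F y)) (D i) x := fun i =>
    ((hF i).differentiableAt (ball_mem_nhds _ hr)).hasFDerivAt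
  -- the uniform second-order estimate
  have key : ∀ i v, ‖v‖ < r →
      ‖ev i (F (x + v)) - ev i (F x) - D i v‖ ≤ 4 * M / r ^ 2 * ‖v‖ ^ 2 := by
    intro i v hv
    rcases eq_or_ne v 0 with rfl | hv0
    · simp
    have hvpos : 0 < ‖v‖ := norm_pos_iff.2 hv0
    have hmaps : ∀ s ∈ ball (0 : ℂ) (r / ‖v‖), x + s • v ∈ ball x r := by
      intro s hs
      rw [mem_ball_zero_iff, lt_div_iff₀ hvpos] at hs
      simpa [mem_ball, dist_eq_norm, norm_smul] using hs
    have hd : DifferentiableOn ℂ (fun s : ℂ => ev i (F (x + s • v))) (ball 0 (r / ‖v‖)) :=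
      (hF i).comp (f := fun s : ℂ => x + s • v) (by fun_prop) hmaps
    have hder : deriv (fun s : ℂ => ev i (F (x + s • v))) 0 = D i v := by
      have h1 : HasDerivAt (fun s : ℂ => x + s • v) v 0 := by
        simpa using ((hasDerivAt_id (0 : ℂ)).smul_const v).const_add x
      have h2 : HasFDerivAt (fun y => ev i (F y)) (D i) (x + (0 : ℂ) • v) := by simpa using hD i
      exact (h2.comp_hasDerivAt (0 : ℂ) h1).deriv
    have h1 : (1 : ℂ) ∈ ball (0 : ℂ) (r / ‖v‖) := by
      rw [mem_ball_zero_iff, norm_one, lt_div_iff₀ hvpos]; simpa using hv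
    have := norm_sub_sub_mul_deriv_le hd (fun s hs => hM i _ (hmaps s hs)) h1
    rw [hder] at this
    simp only [one_smul, zero_smul, add_zero, one_mul, norm_one, one_pow, mul_one] at this
    refine this.trans (le_of_eq ?_)
    field_simp
  have hC : 0 ≤ 4 * M / r ^ 2 := by positivity
  -- the derivative exists as a vector of `B`
  have hex : ∀ v : E, ∃ b : B, ∀ i, ev i b = D i v := by
    intro v
    have hlim : Tendsto (fun n : ℕ => ‖v‖ * (1 / ((n : ℝ) + 1))) atTop (𝓝 0) := by
      simpa using tendsto_one_div_add_atTop_nhds_zero_nat.const_mul ‖v‖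
    obtain ⟨n₀, hn₀⟩ := eventually_atTop.1 (hlim.eventually (gt_mem_nhds hr))
    let t : ℕ → ℂ := fun n => ((n + n₀ : ℕ) : ℂ) + 1
    have ht : ∀ n, t n ≠ 0 := fun n => Nat.cast_add_one_ne_zero _
    have htn : ∀ n, ‖t n‖ = ((n + n₀ : ℕ) : ℝ) + 1 := fun n => by
      have : t n = (((n + n₀ + 1 : ℕ) : ℝ) : ℂ) := by simp [t]
      rw [this, Complex.norm_real, Real.norm_of_nonneg (by positivity)]
      push_cast; ring
    let b : ℕ → B := fun n => t n • (F (x + (t n)⁻¹ • v) - F x)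
    let c : ℕ → ℝ := fun n => 4 * M / r ^ 2 * ‖v‖ ^ 2 * (1 / (((n + n₀ : ℕ) : ℝ) + 1))
    have hb : ∀ i n, ‖ev i (b n) - D i v‖ ≤ c n := by
      intro i n
      have h1 : ‖(t n)⁻¹ • v‖ < r := by
        rw [norm_smul, norm_inv, htn, mul_comm, ← one_div]
        exact hn₀ _ (by omega)
      have h2 := key i _ h1
      have h3 : ev i (b n) - D i v
          = t n * (ev i (F (x + (t n)⁻¹ • v)) - ev i (F x) - D i ((t n)⁻¹ • v)) := by
        simp only [b, map_smul, map_sub, smul_eq_mul]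
        have := ht n
        field_simp
      rw [h3, norm_mul]
      refine (mul_le_mul_of_nonneg_left h2 (norm_nonneg _)).trans (le_of_eq ?_)
      rw [norm_smul, norm_inv, htn]
      simp only [c]
      have : (((n + n₀ : ℕ) : ℝ) + 1) ≠ 0 := by positivity
      field_simp
    have hc : Tendsto c atTop (𝓝 0) := by
      have h := (tendsto_one_div_add_atTop_nhds_zero_nat (𝕜 := ℝ)).comp (tendsto_add_atTop_nat n₀)
      simpa [c, Function.comp_def] using h.const_mul (4 * M / r ^ 2 * ‖v‖ ^ 2)
    have hanti : ∀ n m, n ≤ m → c m ≤ c n := by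
      intro n m hnm
      simp only [c]
      gcongr
    have hcauchy : CauchySeq b := by
      refine cauchySeq_of_le_tendsto_0 (fun n => 2 * c n) (fun n m k hn hm => ?_)
        (by simpa using hc.const_mul 2)
      rw [dist_eq_norm]
      refine hev _ _ (by simp only [c]; positivity) fun i => ?_
      have : ev i (b n - b m) = (ev i (b n) - D i v) - (ev i (b m) - D i v) := by
        rw [map_sub]; ring
      rw [this]
      linarith [norm_sub_le (ev i (b n) - D i v) (ev i (b m) - D i v), hb i n, hb i m,
        hanti _ _ hn, hanti _ _ hm]
    obtain ⟨b₀, hb₀⟩ := cauchySeq_tendsto_of_complete hcauchy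
    refine ⟨b₀, fun i => tendsto_nhds_unique (((ev i).continuous.tendsto _).comp hb₀) ?_⟩
    rw [tendsto_iff_norm_sub_tendsto_zero]
    exact squeeze_zero (fun _ => norm_nonneg _) (hb i) hc
  choose L hL using hex
  let L' : E →ₗ[ℂ] B :=
    { toFun := L
      map_add' := fun v w => hext _ _ fun i => by simp [hL]
      map_smul' := fun a v => hext _ _ fun i => by simp [hL] }
  refine HasFDerivAt.differentiableAt (f' := LinearMap.toContinuousLinearMap L') ?_
  rw [hasFDerivAt_iff_isLittleO_nhds_zero]
  have hO : (fun v => F (x + v) - F x - LinearMap.toContinuousLinearMap L' v)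
      =O[𝓝 0] fun v => ‖v‖ ^ 2 := by
    refine Asymptotics.IsBigO.of_bound (4 * M / r ^ 2) ?_
    filter_upwards [ball_mem_nhds (0 : E) hr] with v hv
    rw [norm_pow, norm_norm]
    refine hev _ _ (by positivity) fun i => ?_
    have := key i v (by simpa using hv)
    simpa [L', hL] using this
  refine hO.trans_isLittleO ?_
  exact Asymptotics.isLittleO_norm_pow_id one_lt_two

/-- The bounded holomorphic functions on the disc of radius `ρ`, extended by zero, as a subspace of
the bounded functions on `ℂ`. -/
def boundedHolomorphicSubmodule (ρ : ℝ) : Submodule ℂ (lp (fun _ : ℂ => ℂ) ⊤) where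
  carrier := {b | DifferentiableOn ℂ (fun z => b z) (ball 0 ρ) ∧ ∀ z ∉ ball (0 : ℂ) ρ, b z = 0}
  add_mem' := by
    rintro a b ⟨ha, ha'⟩ ⟨hb, hb'⟩
    exact ⟨ha.add hb, fun z hz => by simp [ha' z hz, hb' z hz]⟩
  zero_mem' := ⟨differentiableOn_const (0 : ℂ), fun _ _ => rfl⟩
  smul_mem' := by
    rintro c a ⟨ha, ha'⟩
    exact ⟨ha.const_smul c, fun z hz => by simp [ha' z hz]⟩

/-- The space of bounded holomorphic functions on the disc of radius `ρ`, with the sup norm. -/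
def BoundedHolomorphic (ρ : ℝ) : Type := boundedHolomorphicSubmodule ρ

namespace BoundedHolomorphic

variable {ρ : ℝ}

noncomputable instance : NormedAddCommGroup (BoundedHolomorphic ρ) :=
  inferInstanceAs (NormedAddCommGroup (boundedHolomorphicSubmodule ρ))

noncomputable instance : NormedSpace ℂ (BoundedHolomorphic ρ) :=
  inferInstanceAs (NormedSpace ℂ (boundedHolomorphicSubmodule ρ))

/-- Evaluation at a point. -/
noncomputable def ev (ρ : ℝ) (z : ℂ) : BoundedHolomorphic ρ →L[ℂ] ℂ :=
  (lp.evalCLM ℂ (fun _ : ℂ => ℂ) ⊤ z).comp (boundedHolomorphicSubmodule ρ).subtypeL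

lemma differentiableOn_ev (b : BoundedHolomorphic ρ) :
    DifferentiableOn ℂ (fun z => ev ρ z b) (ball 0 ρ) := b.2.1

lemma norm_ev_le (z : ℂ) (b : BoundedHolomorphic ρ) : ‖ev ρ z b‖ ≤ ‖b‖ :=
  lp.norm_apply_le_norm ENNReal.top_ne_zero b.1 z

lemma norm_le_of_forall_ball (b : BoundedHolomorphic ρ) {C : ℝ} (hC : 0 ≤ C)
    (h : ∀ z ∈ ball (0 : ℂ) ρ, ‖ev ρ z b‖ ≤ C) : ‖b‖ ≤ C := by
  refine lp.norm_le_of_forall_le (f := b.1) hC fun z => ?_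
  by_cases hz : z ∈ ball (0 : ℂ) ρ
  · exact h z hz
  · rw [b.2.2 z hz, norm_zero]; exact hC

lemma ext_ball {a b : BoundedHolomorphic ρ}
    (h : ∀ z ∈ ball (0 : ℂ) ρ, ev ρ z a = ev ρ z b) : a = b :=
  sub_eq_zero.1 <| norm_le_zero_iff.1 <| norm_le_of_forall_ball _ le_rfl fun z hz => by
    rw [(ev ρ z).map_sub a b, h z hz, sub_self, norm_zero]

lemma exists_of_differentiableOn {φ : ℂ → ℂ} {M : ℝ} (hφ : DifferentiableOn ℂ φ (ball 0 ρ))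
    (hM : ∀ z ∈ ball (0 : ℂ) ρ, ‖φ z‖ ≤ M) :
    ∃ b : BoundedHolomorphic ρ, ∀ z ∈ ball (0 : ℂ) ρ, ev ρ z b = φ z := by
  classical
  let f : ℂ → ℂ := fun z => if z ∈ ball (0 : ℂ) ρ then φ z else 0
  have hf : ∀ z ∈ ball (0 : ℂ) ρ, f z = φ z := fun z hz => if_pos hz
  have hmem : Memℓp f ⊤ := by
    refine memℓp_infty ⟨max M 0, ?_⟩
    rintro _ ⟨z, rfl⟩
    by_cases hz : z ∈ ball (0 : ℂ) ρ
    · exact le_max_of_le_left ((congrArg norm (hf z hz)).trans_le (hM z hz))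
    · simp only [f, hz, if_false, norm_zero]
      exact le_max_right _ _
  exact ⟨⟨⟨f, hmem⟩, hφ.congr hf, fun z hz => if_neg hz⟩, hf⟩

instance : CompleteSpace (BoundedHolomorphic ρ) := by
  change CompleteSpace (boundedHolomorphicSubmodule ρ)
  refine IsClosed.completeSpace_coe (hs := ?_)
  refine IsSeqClosed.isClosed fun b b₀ hb hlim => ?_
  have hun : TendstoUniformly (fun n z => b n z) (fun z => b₀ z) atTop := by
    rw [Metric.tendstoUniformly_iff]
    intro ε hε
    filter_upwards [(Metric.tendsto_nhds.1 hlim) ε hε] with n hn z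
    rw [dist_eq_norm] at hn
    rw [dist_comm, dist_eq_norm]
    exact (lp.norm_apply_le_norm ENNReal.top_ne_zero (b n - b₀) z).trans_lt hn
  refine ⟨hun.tendstoUniformlyOn.tendstoLocallyUniformlyOn.differentiableOn
    (Eventually.of_forall fun n => (hb n).1) isOpen_ball, fun z hz => ?_⟩
  refine tendsto_nhds_unique (hun.tendsto_at z) ?_
  simp [(hb _).2 z hz]

/-- Pointwise multiplication. -/
noncomputable def mul (ρ : ℝ) :
    BoundedHolomorphic ρ →L[ℂ] BoundedHolomorphic ρ →L[ℂ] BoundedHolomorphic ρ :=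
  LinearMap.mkContinuous₂
    (LinearMap.mk₂ ℂ (fun a b => (⟨a.1 * b.1, a.2.1.mul b.2.1, fun z hz => by
        simp [a.2.2 z hz]⟩ : BoundedHolomorphic ρ))
      (fun _ _ _ => Subtype.ext (add_mul _ _ _)) (fun _ _ _ => Subtype.ext (smul_mul_assoc _ _ _))
      (fun _ _ _ => Subtype.ext (mul_add _ _ _)) (fun _ _ _ => Subtype.ext (mul_smul_comm _ _ _)))
    1 fun a b => by
      rw [one_mul]
      exact norm_mul_le a.1 b.1

@[simp] lemma ev_mul (z : ℂ) (a b : BoundedHolomorphic ρ) :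
    ev ρ z (mul ρ a b) = ev ρ z a * ev ρ z b := rfl

lemma exists_shift (hρ : 0 < ρ) :
    ∃ S : BoundedHolomorphic ρ →L[ℂ] BoundedHolomorphic ρ,
      ∀ b, ∀ z ∈ ball (0 : ℂ) ρ, ev ρ z b = ev ρ 0 b + z * ev ρ z (S b) := by
  have hnhds : ball (0 : ℂ) ρ ∈ 𝓝 (0 : ℂ) := ball_mem_nhds _ hρ
  have hbound : ∀ b : BoundedHolomorphic ρ, ∀ z ∈ ball (0 : ℂ) ρ,
      ‖dslope (fun z => ev ρ z b) 0 z‖ ≤ 2 * ‖b‖ / ρ := fun b z hz =>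
    Complex.norm_dslope_le_div_of_mapsTo_ball (differentiableOn_ev b) (fun w hw => by
      rw [mem_closedBall, dist_eq_norm]
      linarith [norm_sub_le (ev ρ w b) (ev ρ 0 b), norm_ev_le w b, norm_ev_le 0 b]) hz
  have hex : ∀ b : BoundedHolomorphic ρ, ∃ c : BoundedHolomorphic ρ,
      ∀ z ∈ ball (0 : ℂ) ρ, ev ρ z c = dslope (fun z => ev ρ z b) 0 z := fun b =>
    exists_of_differentiableOn
      ((Complex.differentiableOn_dslope hnhds).2 (differentiableOn_ev b)) (hbound b)
  choose S hS using hex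
  have hdiff : ∀ b : BoundedHolomorphic ρ, DifferentiableAt ℂ (fun z => ev ρ z b) 0 := fun b =>
    (differentiableOn_ev b).differentiableAt hnhds
  let S' : BoundedHolomorphic ρ →ₗ[ℂ] BoundedHolomorphic ρ :=
    { toFun := S
      map_add' := fun a b => ext_ball fun z hz => by
        rw [map_add, hS _ z hz, hS _ z hz, hS _ z hz]
        rcases eq_or_ne z 0 with rfl | h0
        · simp only [dslope_same, map_add]
          exact deriv_add (hdiff a) (hdiff b)
        · simp only [dslope_of_ne _ h0, slope_def_field, map_add]
          ring
      map_smul' := fun c b => ext_ball fun z hz => by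
        rw [RingHom.id_apply, map_smul, hS _ z hz, hS _ z hz]
        rcases eq_or_ne z 0 with rfl | h0
        · simp only [dslope_same, map_smul]
          exact deriv_const_smul c (hdiff b)
        · simp only [dslope_of_ne _ h0, slope_def_field, map_smul, smul_eq_mul]
          ring }
  refine ⟨S'.mkContinuous (2 / ρ) fun b => ?_, fun b z hz => ?_⟩
  · refine norm_le_of_forall_ball _ (by positivity) fun z hz => ?_
    change ‖ev ρ z (S b)‖ ≤ _
    rw [hS b z hz]
    exact (hbound b z hz).trans (le_of_eq (by ring))
  · change _ = _ + z * ev ρ z (S b)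
    rw [hS b z hz]
    have := sub_smul_dslope (fun z => ev ρ z b) 0 z
    simp only [sub_zero, smul_eq_mul] at this
    rw [this]; ring

/-- A family of bounded holomorphic functions depending holomorphically on a parameter, pointwise,
depends holomorphically on it in norm. -/
lemma differentiableAt_of_ev {E : Type*} [NormedAddCommGroup E] [NormedSpace ℂ E]
    [FiniteDimensional ℂ E] {F : E → BoundedHolomorphic ρ} {x : E} {r M : ℝ} (hr : 0 < r)
    (hF : ∀ z ∈ ball (0 : ℂ) ρ, DifferentiableOn ℂ (fun y => ev ρ z (F y)) (ball x r))
    (hM : ∀ z ∈ ball (0 : ℂ) ρ, ∀ y ∈ ball x r, ‖ev ρ z (F y)‖ ≤ M) :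
    DifferentiableAt ℂ F x :=
  differentiableAt_of_forall_differentiableOn (ι := ball (0 : ℂ) ρ) (fun z => ev ρ z)
    (fun b _ hC h => norm_le_of_forall_ball b hC fun z hz => h ⟨z, hz⟩) hr
    (fun z => hF z z.2) fun z => hM z z.2

lemma differentiableAt_ev {z : ℂ} (hz : z ∈ ball (0 : ℂ) ρ) :
    DifferentiableAt ℂ (fun w => ev ρ w) z := by
  obtain ⟨r, hr, hsub⟩ := Metric.isOpen_iff.1 isOpen_ball z hz
  refine differentiableAt_of_forall_differentiableOn
    (ι := closedBall (0 : BoundedHolomorphic ρ) 1)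
    (B := BoundedHolomorphic ρ →L[ℂ] ℂ)
    (fun b => ContinuousLinearMap.apply ℂ ℂ b.1) ?_ (M := 1) hr ?_ ?_
  · intro A C hC h
    refine ContinuousLinearMap.opNorm_le_of_unit_norm hC fun b hb => ?_
    exact h ⟨b, by simp [hb]⟩
  · exact fun b => (differentiableOn_ev b.1).mono hsub
  · rintro ⟨b, hb⟩ w -
    exact (norm_ev_le w b).trans (by simpa using hb)

lemma differentiableAt_ev_apply {E : Type*} [NormedAddCommGroup E] [NormedSpace ℂ E]
    {F : E → BoundedHolomorphic ρ} {p : ℂ × E} (hF : DifferentiableAt ℂ F p.2)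
    (hp : p.1 ∈ ball (0 : ℂ) ρ) : DifferentiableAt ℂ (fun p : ℂ × E => ev ρ p.1 (F p.2)) p := by
  have h1 : DifferentiableAt ℂ ((fun w => ev ρ w) ∘ (Prod.fst : ℂ × E → ℂ)) p :=
    DifferentiableAt.comp (E := ℂ × E) (F := ℂ) (G := BoundedHolomorphic ρ →L[ℂ] ℂ) p
      (differentiableAt_ev hp) differentiableAt_fst
  have h2 : DifferentiableAt ℂ (F ∘ (Prod.snd : ℂ × E → E)) p :=
    hF.comp p differentiableAt_snd
  exact h1.clm_apply h2

lemma exists_parametrized {E : Type*} [NormedAddCommGroup E] [NormedSpace ℂ E]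
    [FiniteDimensional ℂ E] {g : ℂ × E → ℂ} {M : ℝ}
    (hg : DifferentiableOn ℂ g (ball 0 ρ)) (hM : ∀ p ∈ ball (0 : ℂ × E) ρ, ‖g p‖ ≤ M) :
    ∃ G : E → BoundedHolomorphic ρ,
      (∀ x ∈ ball (0 : E) ρ, ∀ z ∈ ball (0 : ℂ) ρ, ev ρ z (G x) = g (z, x)) ∧
      ∀ x ∈ ball (0 : E) ρ, DifferentiableAt ℂ G x := by
  have hmem : ∀ x ∈ ball (0 : E) ρ, ∀ z ∈ ball (0 : ℂ) ρ, (z, x) ∈ ball (0 : ℂ × E) ρ := by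
    intro x hx z hz
    rw [mem_ball_zero_iff] at *
    exact max_lt hz hx
  have hex : ∀ x : E, ∃ b : BoundedHolomorphic ρ, x ∈ ball (0 : E) ρ →
      ∀ z ∈ ball (0 : ℂ) ρ, ev ρ z b = g (z, x) := by
    intro x
    by_cases hx : x ∈ ball (0 : E) ρ
    · obtain ⟨b, hb⟩ := exists_of_differentiableOn (φ := fun z => g (z, x)) (M := M)
        (hg.comp (f := fun z : ℂ => (z, x)) (by fun_prop) fun z hz => hmem x hx z hz)
        fun z hz => hM _ (hmem x hx z hz)
      exact ⟨b, fun _ => hb⟩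
    · exact ⟨0, fun h => (hx h).elim⟩
  choose G hG using hex
  refine ⟨G, hG, fun x hx => ?_⟩
  obtain ⟨r, hr, hsub⟩ := Metric.isOpen_iff.1 isOpen_ball x hx
  refine differentiableAt_of_ev (M := M) hr (fun z hz => ?_) fun z hz y hy => ?_
  · exact (hg.comp (f := fun y : E => (z, y)) (by fun_prop)
      fun y hy => hmem y (hsub hy) z hz).congr fun y hy => hG y (hsub hy) z hz
  · rw [hG y (hsub hy) z hz]
    exact hM _ (hmem y (hsub hy) z hz)

lemma ev_eq_sum_shift {S : BoundedHolomorphic ρ →L[ℂ] BoundedHolomorphic ρ}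
    (hS : ∀ b, ∀ z ∈ ball (0 : ℂ) ρ, ev ρ z b = ev ρ 0 b + z * ev ρ z (S b)) (m : ℕ)
    (b : BoundedHolomorphic ρ) {z : ℂ} (hz : z ∈ ball (0 : ℂ) ρ) :
    ev ρ z b = ∑ j ∈ Finset.range m, ev ρ 0 ((S ^ j) b) * z ^ j + z ^ m * ev ρ z ((S ^ m) b) := by
  induction m with
  | zero => simp
  | succ m ih =>
    have h : (S ^ (m + 1)) b = S ((S ^ m) b) := by rw [pow_succ']; rfl
    rw [Finset.sum_range_succ, h, ih, hS ((S ^ m) b) z hz]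
    ring

end BoundedHolomorphic

lemma eventually_norm_le {X : Type*} [TopologicalSpace X] {k : X → ℂ} {x : X}
    (hk : ContinuousAt k x) : ∀ᶠ y in 𝓝 x, ‖k y‖ ≤ ‖k x‖ + 1 :=
  (hk.norm.eventually (gt_mem_nhds (lt_add_one _))).mono fun _ h => h.le

open BoundedHolomorphic in
/-- **Weierstrass division theorem** for germs of holomorphic functions. -/
theorem exists_weierstrass_division {E : Type*} [NormedAddCommGroup E] [NormedSpace ℂ E]
    [FiniteDimensional ℂ E] {g h : ℂ × E → ℂ} (hg : ∀ᶠ p in 𝓝 0, DifferentiableAt ℂ g p)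
    {m : ℕ} {u : ℂ → ℂ} (hu : AnalyticAt ℂ u 0) (hu0 : u 0 ≠ 0)
    (hgu : ∀ᶠ z in 𝓝 (0 : ℂ), g (z, 0) = z ^ m * u z)
    (hh : ∀ᶠ p in 𝓝 0, DifferentiableAt ℂ h p) :
    ∃ (q : ℂ × E → ℂ) (r : ℕ → E → ℂ), (∀ᶠ p in 𝓝 0, DifferentiableAt ℂ q p) ∧
      (∀ j, ∀ᶠ x in 𝓝 0, DifferentiableAt ℂ (r j) x) ∧
      ∀ᶠ p in 𝓝 0, h p = g p * q p + ∑ j ∈ Finset.range m, r j p.2 * p.1 ^ j := by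
  obtain ⟨δ₁, hδ₁, H₁⟩ := Metric.eventually_nhds_iff_ball.1 ((hg.and hh).and
    ((eventually_norm_le hg.self_of_nhds.continuousAt).and
      (eventually_norm_le hh.self_of_nhds.continuousAt)))
  obtain ⟨δ₂, hδ₂, H₂⟩ := Metric.eventually_nhds_iff_ball.1 ((hgu.and hu.eventually_analyticAt).and
    ((hu.continuousAt.eventually_ne hu0).and (eventually_norm_le (hu.continuousAt.inv₀ hu0))))
  let ρ := min δ₁ δ₂
  have hρ : 0 < ρ := lt_min hδ₁ hδ₂
  replace H₁ : ∀ p ∈ ball (0 : ℂ × E) ρ, _ := fun p hp =>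
    H₁ p (ball_subset_ball (min_le_left _ _) hp)
  replace H₂ : ∀ z ∈ ball (0 : ℂ) ρ, _ := fun z hz =>
    H₂ z (ball_subset_ball (min_le_right _ _) hz)
  obtain ⟨G, hG, hGd⟩ := exists_parametrized
    (fun p hp => (H₁ p hp).1.1.differentiableWithinAt) fun p hp => (H₁ p hp).2.1
  obtain ⟨H, hH, hHd⟩ := exists_parametrized
    (fun p hp => (H₁ p hp).1.2.differentiableWithinAt) fun p hp => (H₁ p hp).2.2
  obtain ⟨w, hw⟩ := exists_of_differentiableOn (φ := u⁻¹)
    (fun z hz => ((H₂ z hz).1.2.differentiableAt.inv (H₂ z hz).2.1).differentiableWithinAt)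
    fun z hz => (H₂ z hz).2.2
  have hpow : ∀ j : ℕ, ∃ e : BoundedHolomorphic ρ, ∀ z ∈ ball (0 : ℂ) ρ, ev ρ z e = z ^ j :=
    fun j => exists_of_differentiableOn (M := ρ ^ j) (by fun_prop) fun z hz => by
      rw [norm_pow]
      exact pow_le_pow_left₀ (norm_nonneg _) (mem_ball_zero_iff.1 hz).le _
  choose e he using hpow
  obtain ⟨S, hS⟩ := exists_shift hρ
  have h0E : (0 : E) ∈ ball (0 : E) ρ := mem_ball_self hρ
  have h0 : (0 : ℂ) ∈ ball (0 : ℂ) ρ := mem_ball_self hρ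
  let K : BoundedHolomorphic ρ →L[ℂ] BoundedHolomorphic ρ :=
    ∑ j ∈ Finset.range m, ((ev ρ 0).comp (S ^ j)).smulRight (e j)
  let T : BoundedHolomorphic ρ →L[ℂ] BoundedHolomorphic ρ := (mul ρ w).comp (S ^ m)
  let Φ : E → (BoundedHolomorphic ρ →L[ℂ] BoundedHolomorphic ρ) :=
    fun x => K + (mul ρ (G x)).comp T
  have hΦ : ∀ x b, ∀ z ∈ ball (0 : ℂ) ρ, ev ρ z (Φ x b) =
      ∑ j ∈ Finset.range m, ev ρ 0 ((S ^ j) b) * z ^ j + ev ρ z (G x) * ev ρ z (T b) := by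
    intro x b z hz
    simp only [Φ, K, add_apply, ContinuousLinearMap.comp_apply,
      sum_apply, ContinuousLinearMap.smulRight_apply, map_add, map_sum,
      map_smul, smul_eq_mul, ev_mul]
    congr 1
    exact Finset.sum_congr rfl fun j _ => by rw [he j z hz]
  have hΦ0 : Φ 0 = 1 := by
    ext1 b
    refine ext_ball fun z hz => ?_
    rw [hΦ 0 b z hz, hG 0 h0E z hz, (H₂ z hz).1.1]
    change _ + _ * (ev ρ z w * ev ρ z ((S ^ m) b)) = ev ρ z b
    rw [hw z hz, ev_eq_sum_shift hS m b hz, Pi.inv_apply]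
    have := (H₂ z hz).2.1
    field_simp
  have hΦd : ∀ x ∈ ball (0 : E) ρ, DifferentiableAt ℂ Φ x := by
    intro x hx
    have h1 : DifferentiableAt ℂ (fun x => mul ρ (G x)) x :=
      (mul ρ).differentiableAt.comp x (hGd x hx)
    exact (h1.clm_comp (differentiableAt_const T)).const_add K
  have hunit : ∀ᶠ x in 𝓝 (0 : E), IsUnit (Φ x) := by
    refine (hΦd 0 h0E).continuousAt.eventually ?_
    rw [hΦ0]
    exact Units.nhds 1
  let b : E → BoundedHolomorphic ρ := fun x => Ring.inverse (Φ x) (H x)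
  have hball : ∀ᶠ x in 𝓝 (0 : E), x ∈ ball (0 : E) ρ := ball_mem_nhds _ hρ
  have hbd : ∀ᶠ x in 𝓝 (0 : E), DifferentiableAt ℂ b x := by
    filter_upwards [hunit, hball] with x hx hx'
    have h1 : DifferentiableAt ℂ (fun x => Ring.inverse (Φ x)) x :=
      DifferentiableAt.comp x (differentiableAt_inverse hx) (hΦd x hx')
    exact h1.clm_apply (hHd x hx')
  have hfst : Tendsto (Prod.fst : ℂ × E → ℂ) (𝓝 0) (𝓝 0) := continuous_fst.tendsto' _ _ rfl
  have hsnd : Tendsto (Prod.snd : ℂ × E → E) (𝓝 0) (𝓝 0) := continuous_snd.tendsto' _ _ rfl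
  have hball' : ∀ᶠ p in 𝓝 (0 : ℂ × E), p.1 ∈ ball (0 : ℂ) ρ :=
    hfst.eventually (ball_mem_nhds _ hρ)
  refine ⟨fun p => ev ρ p.1 (T (b p.2)), fun j x => ev ρ 0 ((S ^ j) (b x)), ?_, fun j => ?_, ?_⟩
  · filter_upwards [hsnd.eventually hbd, hball'] with p hp hp'
    have h1 : DifferentiableAt ℂ (fun x => T (b x)) p.2 := T.differentiableAt.comp p.2 hp
    exact differentiableAt_ev_apply h1 hp'
  · filter_upwards [hbd] with x hx
    exact ((ev ρ 0).comp (S ^ j)).differentiableAt.comp x hx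
  · filter_upwards [hsnd.eventually hunit, hsnd.eventually hball, hball'] with p hp hp' hz
    have h1 : Φ p.2 (b p.2) = H p.2 := by
      change (Φ p.2 * Ring.inverse (Φ p.2)) (H p.2) = H p.2
      rw [Ring.mul_inverse_cancel _ hp]; rfl
    have h2 := hΦ p.2 (b p.2) p.1 hz
    rw [h1, hH _ hp' _ hz, hG _ hp' _ hz] at h2
    rw [h2, add_comm]

open Polynomial in
/-- Let `ψ : A → K[ε]` be a ring homomorphism which is determined, up to first order, by its
reduction modulo `ε`. If `α` is integral over `A`, then `ψ` extends to `A[α]` with the same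
property. -/
theorem exists_dualNumber_extension {A K : Type*} [CommRing A] [Field K] [CharZero K]
    (ψ : A →+* DualNumber K) (hψ : ∀ a, (ψ a).fst = 0 → ψ a = 0) (α : K) {W : A[X]}
    (hW : W.Monic)
    (hWα : (eval₂ ψ (TrivSqZeroExt.inl α) W).fst = 0) :
    ∃ β : K, ∀ R : A[X], (eval₂ ψ (TrivSqZeroExt.inl α + TrivSqZeroExt.inr β) R).fst = 0 →
      eval₂ ψ (TrivSqZeroExt.inl α + TrivSqZeroExt.inr β) R = 0 := by
  classical
  let π : DualNumber K →+* K := (TrivSqZeroExt.fstHom K K K : DualNumber K →+* K)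
  have hπ : ∀ x, π x = x.fst := fun _ => rfl
  let φ : A →+* K := π.comp ψ
  have hfst : ∀ (R : A[X]) (β : K),
      (eval₂ ψ (TrivSqZeroExt.inl α + TrivSqZeroExt.inr β) R).fst = eval₂ φ α R := by
    intro R β
    rw [← hπ, hom_eval₂]
    simp [hπ, φ]
  have hzero : ∀ R : A[X], R.map φ = 0 → ∀ x, eval₂ ψ x R = 0 := by
    intro R hR x
    have : R.map ψ = 0 := by
      ext1 n
      rw [coeff_map, coeff_zero]
      refine hψ _ ?_
      have := congrArg (fun P => P.coeff n) hR
      rwa [coeff_map, coeff_zero] at this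
    rw [← eval_map, this, eval_zero]
  -- an annihilating polynomial of minimal degree
  let Pr : ℕ → Prop := fun n => ∃ F : A[X], F.natDegree = n ∧ F.map φ ≠ 0 ∧ eval₂ φ α F = 0
  have hPr : ∃ n, Pr n := by
    refine ⟨_, W, rfl, (hW.map φ).ne_zero, ?_⟩
    rw [← hfst W 0]
    simpa using hWα
  obtain ⟨F, hFn, hF0, hFα⟩ := Nat.find_spec hPr
  have hmin : ∀ R : A[X], eval₂ φ α R = 0 → R.natDegree < F.natDegree → R.map φ = 0 := by
    intro R hR hlt
    by_contra h
    exact Nat.find_min hPr (hFn ▸ hlt) ⟨R, rfl, h, hR⟩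
  have hdeg : 0 < F.natDegree := by
    rw [Nat.pos_iff_ne_zero]
    intro h
    rw [eq_C_of_natDegree_eq_zero h] at hFα hF0
    rw [eval₂_C] at hFα
    exact hF0 (by rw [map_C, hFα, C_0])
  have hlc : φ F.leadingCoeff ≠ 0 := by
    intro h
    have hmap : F.eraseLead.map φ = F.map φ := by
      conv_rhs => rw [← eraseLead_add_C_mul_X_pow F]
      rw [Polynomial.map_add, Polynomial.map_mul, map_C, h, C_0, zero_mul, add_zero]
    refine hF0 (hmap ▸ hmin F.eraseLead ?_ ?_)
    · rw [← eval_map, hmap, eval_map, hFα]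
    · exact lt_of_le_of_lt (eraseLead_natDegree_le F) (by omega)
  have hder : eval₂ φ α (derivative F) ≠ 0 := by
    intro h
    have h1 := hmin _ h (natDegree_derivative_lt hdeg.ne')
    rw [← derivative_map] at h1
    have h2 := derivative_eq_zero.1 h1
    rw [eq_C_of_natDegree_eq_zero h2] at hF0
    rw [← eval_map, eq_C_of_natDegree_eq_zero h2, eval_C] at hFα
    exact hF0 (by rw [hFα, C_0])
  let β : K := -(eval₂ ψ (TrivSqZeroExt.inl α) F).snd / eval₂ φ α (derivative F)
  let x : DualNumber K := TrivSqZeroExt.inl α + TrivSqZeroExt.inr β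
  have hFx : eval₂ ψ x F = 0 := by
    have hfd : (eval₂ ψ (TrivSqZeroExt.inl α) (derivative F)).fst = eval₂ φ α (derivative F) := by
      rw [← hfst _ 0]; simp
    have hff : (eval₂ ψ (TrivSqZeroExt.inl α) F).fst = 0 := by
      rw [← hFα, ← hfst _ 0]; simp
    have hsq : (TrivSqZeroExt.inr β : DualNumber K) ^ 2 = 0 := by
      rw [pow_two, TrivSqZeroExt.inr_mul_inr]
    rw [← eval_map, eval_add_of_sq_eq_zero _ _ _ hsq, derivative_map, eval_map, eval_map]
    ext
    · simp [hff]
    · simp only [TrivSqZeroExt.snd_add, TrivSqZeroExt.snd_mul, TrivSqZeroExt.snd_inr,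
        TrivSqZeroExt.fst_inr, hfd, TrivSqZeroExt.snd_zero, smul_eq_mul, MulOpposite.op_zero,
        zero_smul, add_zero, β]
      field_simp
      ring
  have hunit : IsUnit (ψ F.leadingCoeff) :=
    TrivSqZeroExt.isUnit_iff_isUnit_fst.2 (isUnit_iff_ne_zero.2 hlc)
  refine ⟨β, fun R hR => ?_⟩
  rw [hfst] at hR
  induction hn : R.natDegree using Nat.strong_induction_on generalizing R with
  | _ n ih =>
    subst hn
    by_cases hlt : R.natDegree < F.natDegree
    · exact hzero R (hmin R hR hlt) x
    · push Not at hlt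
      have h1 : eval₂ φ α (F.cancelLeads R) = 0 := by
        simp [cancelLeads, eval₂_mul, eval₂_sub, hR, hFα]
      have h2 := ih _ (natDegree_cancelLeads_lt_of_natDegree_le_natDegree hlt
        (hdeg.trans_le hlt)) _ h1 rfl
      have h3 : eval₂ ψ x (F.cancelLeads R) = ψ F.leadingCoeff * eval₂ ψ x R := by
        rw [cancelLeads, Nat.sub_eq_zero_of_le hlt, pow_zero, mul_one]
        simp only [eval₂_sub, eval₂_mul, eval₂_C, hFx, mul_zero, sub_zero]
      exact hunit.mul_right_eq_zero.1 (h3.symm.trans h2)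

/-- The ring of functions which are holomorphic near the origin. -/
def holomorphicNear (E : Type*) [NormedAddCommGroup E] [NormedSpace ℂ E] : Subring (E → ℂ) where
  carrier := {h | ∀ᶠ p in 𝓝 0, DifferentiableAt ℂ h p}
  mul_mem' ha hb := by filter_upwards [ha, hb] with p h₁ h₂ using h₁.mul h₂
  one_mem' := Eventually.of_forall fun _ => differentiableAt_const (1 : ℂ)
  add_mem' ha hb := by filter_upwards [ha, hb] with p h₁ h₂ using h₁.add h₂
  zero_mem' := Eventually.of_forall fun _ => differentiableAt_const (0 : ℂ)
  neg_mem' ha := by filter_upwards [ha] with p h₁ using h₁.neg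

namespace holomorphicNear

variable {E F X : Type*} [NormedAddCommGroup E] [NormedSpace ℂ E] [NormedAddCommGroup F]
  [NormedSpace ℂ F]

/-- Composition with a continuous linear map. -/
noncomputable def comp (L : E →L[ℂ] F) : holomorphicNear F →+* holomorphicNear E where
  toFun h := ⟨h.1 ∘ L, by
    filter_upwards [(L.continuous.tendsto' 0 0 (map_zero L)).eventually h.2] with p hp
    exact hp.comp p L.differentiableAt⟩
  map_one' := rfl
  map_mul' _ _ := rfl
  map_zero' := rfl
  map_add' _ _ := rfl

@[simp] lemma comp_apply (L : E →L[ℂ] F) (h : holomorphicNear F) (x : E) :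
    (comp L h).1 x = h.1 (L x) := rfl

/-- A continuous linear form as a holomorphic function. -/
noncomputable def ofLinear (L : E →L[ℂ] ℂ) : holomorphicNear E :=
  ⟨L, Eventually.of_forall fun _ => L.differentiableAt⟩

lemma analyticAt_smul (h : holomorphicNear E) (w : E) :
    AnalyticAt ℂ (fun z : ℂ => h.1 (z • w)) 0 := by
  rw [Complex.analyticAt_iff_eventually_differentiableAt]
  have ht : Tendsto (fun z : ℂ => z • w) (𝓝 0) (𝓝 0) :=
    (continuous_id.smul continuous_const).tendsto' _ _ (by simp)
  filter_upwards [ht.eventually h.2] with z hz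
  exact DifferentiableAt.comp z hz (by fun_prop)

/-- A holomorphic function which vanishes near the origin on every line vanishes near the
origin. -/
lemma eventually_eq_zero_of_lines (h : holomorphicNear E)
    (hw : ∀ w, ∀ᶠ z : ℂ in 𝓝 0, h.1 (z • w) = 0) : ∀ᶠ x in 𝓝 0, h.1 x = 0 := by
  obtain ⟨r, hr, hd⟩ := Metric.eventually_nhds_iff_ball.1 h.2
  filter_upwards [ball_mem_nhds (0 : E) hr] with x hx
  let L : ℂ →L[ℂ] E := ContinuousLinearMap.toSpanSingleton ℂ x
  have hL : ∀ z, L z = z • x := fun z => ContinuousLinearMap.toSpanSingleton_apply ..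
  let s : Set ℂ := L ⁻¹' ball 0 r
  have hs : IsOpen s := isOpen_ball.preimage L.continuous
  have hconv : Convex ℝ s := (convex_ball (0 : E) r).is_linear_preimage
    ((L.restrictScalars ℝ).toLinearMap.isLinear)
  have han : AnalyticOnNhd ℂ (fun z : ℂ => h.1 (z • x)) s := by
    refine DifferentiableOn.analyticOnNhd (fun z hz => ?_) hs
    have : DifferentiableAt ℂ h.1 (z • x) := hd _ (by simpa [s, hL] using hz)
    exact (DifferentiableAt.comp z this (by fun_prop)).differentiableWithinAt
  have := han.eqOn_zero_of_preconnected_of_eventuallyEq_zero hconv.isPreconnected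
    (z₀ := 0) (by simpa [s] using hr) (hw x) (x := 1) (by simpa [s, hL] using hx)
  simpa using this

/-- Weierstrass division in the ring of functions holomorphic near the origin. -/
theorem exists_division [FiniteDimensional ℂ E] (g : holomorphicNear (ℂ × E))
    (hg : ¬ ∀ᶠ z : ℂ in 𝓝 0, g.1 (z, 0) = 0) :
    ∃ m : ℕ, ∀ h : holomorphicNear (ℂ × E), ∃ (q : holomorphicNear (ℂ × E))
      (r : ℕ → holomorphicNear E), ∀ᶠ p in 𝓝 0,
        h.1 p = g.1 p * q.1 p + ∑ j ∈ Finset.range m, (r j).1 p.2 * p.1 ^ j := by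
  have han : AnalyticAt ℂ (fun z : ℂ => g.1 (z, 0)) 0 := by
    simpa using analyticAt_smul g ((1 : ℂ), (0 : E))
  obtain ⟨m, u, hu, hu0, hgu⟩ := han.exists_eventuallyEq_pow_smul_nonzero_iff.2 hg
  refine ⟨m, fun h => ?_⟩
  obtain ⟨q, r, hq, hr, heq⟩ := exists_weierstrass_division g.2 hu hu0
    (by simpa using hgu) h.2
  exact ⟨⟨q, hq⟩, fun j => ⟨r j, hr j⟩, heq⟩

variable (U : Ultrafilter X)

/-- The first-order jet of a holomorphic function along `γ` in the direction `V`, as a dual number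
over the ultrapower of `ℂ`. -/
noncomputable def jet {γ : X → E} (hγ : Tendsto γ U (𝓝 0)) (V : X → E) :
    holomorphicNear E →+* DualNumber (Germ (U : Filter X) ℂ) where
  toFun h := (((fun x => h.1 (γ x) : X → ℂ) : Germ (U : Filter X) ℂ),
    ((fun x => fderiv ℂ h.1 (γ x) (V x) : X → ℂ) : Germ (U : Filter X) ℂ))
  map_one' := by
    refine TrivSqZeroExt.ext rfl (Germ.coe_eq.2 (Eventually.of_forall fun x => ?_))
    change fderiv ℂ (fun _ => (1 : ℂ)) (γ x) (V x) = 0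
    simp
  map_zero' := by
    refine TrivSqZeroExt.ext rfl (Germ.coe_eq.2 (Eventually.of_forall fun x => ?_))
    change fderiv ℂ (fun _ => (0 : ℂ)) (γ x) (V x) = 0
    simp
  map_add' h k := by
    refine TrivSqZeroExt.ext rfl (Germ.coe_eq.2 ?_)
    filter_upwards [hγ.eventually h.2, hγ.eventually k.2] with x hx kx
    change fderiv ℂ (h.1 + k.1) (γ x) (V x) = fderiv ℂ h.1 (γ x) (V x) + fderiv ℂ k.1 (γ x) (V x)
    rw [fderiv_add hx kx]; rfl
  map_mul' h k := by
    refine TrivSqZeroExt.ext rfl ((Germ.coe_eq (l := (U : Filter X))).2 ?_)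
    filter_upwards [hγ.eventually h.2, hγ.eventually k.2] with x hx kx
    change fderiv ℂ (h.1 * k.1) (γ x) (V x) =
      h.1 (γ x) * fderiv ℂ k.1 (γ x) (V x) + fderiv ℂ h.1 (γ x) (V x) * k.1 (γ x)
    rw [fderiv_mul hx kx]
    simp [mul_comm]

variable {U} {γ : X → E} (hγ : Tendsto γ U (𝓝 0)) (V : X → E)

lemma fst_jet_eq_zero_iff (h : holomorphicNear E) :
    (jet U hγ V h).fst = 0 ↔ ∀ᶠ x in (U : Filter X), h.1 (γ x) = 0 :=
  Germ.coe_eq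

lemma snd_jet_eq_zero_iff (h : holomorphicNear E) :
    (jet U hγ V h).snd = 0 ↔ ∀ᶠ x in (U : Filter X), fderiv ℂ h.1 (γ x) (V x) = 0 :=
  Germ.coe_eq

lemma jet_congr {h k : holomorphicNear E} (hk : ∀ᶠ x in 𝓝 0, h.1 x = k.1 x) :
    jet U hγ V h = jet U hγ V k := by
  refine TrivSqZeroExt.ext (Germ.coe_eq.2 ?_) (Germ.coe_eq.2 ?_)
  · exact hγ.eventually hk
  · filter_upwards [hγ.eventually hk.eventually_nhds] with x hx
    rw [EventuallyEq.fderiv_eq hx]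

lemma jet_comp (L : E →L[ℂ] F) (hLγ : Tendsto (fun x => L (γ x)) U (𝓝 0))
    (h : holomorphicNear F) :
    jet U hγ V (comp L h) = jet U hLγ (fun x => L (V x)) h := by
  refine TrivSqZeroExt.ext rfl (Germ.coe_eq.2 ?_)
  filter_upwards [hLγ.eventually h.2] with x hx
  change fderiv ℂ (h.1 ∘ L) (γ x) (V x) = _
  rw [fderiv_comp (γ x) hx L.differentiableAt, L.fderiv]; rfl

lemma jet_ofLinear (L : E →L[ℂ] ℂ) :
    jet U hγ V (ofLinear L) =
      TrivSqZeroExt.inl ((fun x => L (γ x) : X → ℂ) : Germ (U : Filter X) ℂ) +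
      TrivSqZeroExt.inr ((fun x => L (V x) : X → ℂ) : Germ (U : Filter X) ℂ) := by
  refine TrivSqZeroExt.ext ?_ ?_
  · rw [TrivSqZeroExt.fst_add, TrivSqZeroExt.fst_inl, TrivSqZeroExt.fst_inr, add_zero]; rfl
  · rw [TrivSqZeroExt.snd_add, TrivSqZeroExt.snd_inl, TrivSqZeroExt.snd_inr, zero_add]
    refine Germ.coe_eq.2 (Eventually.of_forall fun x => ?_)
    change fderiv ℂ L (γ x) (V x) = _
    rw [L.fderiv]

/-- `V` is tangent to every hypersurface that contains `γ`. -/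
def IsTangent : Prop :=
  ∀ h : holomorphicNear E, (jet U hγ V h).fst = 0 → jet U hγ V h = 0

end holomorphicNear

lemma charZero_germ {X : Type*} (U : Ultrafilter X) : CharZero (Germ (U : Filter X) ℂ) :=
  charZero_of_injective_ringHom
    (((Germ.coeRingHom (U : Filter X)).comp (Pi.constRingHom X ℂ)).injective)

namespace holomorphicNear

open Polynomial

variable {E F ι : Type*} [NormedAddCommGroup E] [NormedSpace ℂ E] [NormedAddCommGroup F]
  [NormedSpace ℂ F]

/-- Polynomials in the first coordinate, as holomorphic functions. -/
noncomputable def ofPolynomial : (holomorphicNear E)[X] →+* holomorphicNear (ℂ × E) :=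
  eval₂RingHom (comp (ContinuousLinearMap.snd ℂ ℂ E)) (ofLinear (ContinuousLinearMap.fst ℂ ℂ E))

lemma ofPolynomial_apply (R : (holomorphicNear E)[X]) (p : ℂ × E) :
    (ofPolynomial R).1 p =
      (R.map ((Pi.evalRingHom (fun _ : E => ℂ) p.2).comp (holomorphicNear E).subtype)).eval p.1 := by
  let ev : holomorphicNear (ℂ × E) →+* ℂ :=
    (Pi.evalRingHom (fun _ : ℂ × E => ℂ) p).comp (holomorphicNear (ℂ × E)).subtype
  change ev (eval₂ _ _ R) = _
  rw [hom_eval₂, eval_map]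
  rfl

lemma ofPolynomial_sum (m : ℕ) (r : ℕ → holomorphicNear E) (p : ℂ × E) :
    (ofPolynomial (∑ j ∈ Finset.range m, C (r j) * X ^ j)).1 p =
      ∑ j ∈ Finset.range m, (r j).1 p.2 * p.1 ^ j := by
  simp [ofPolynomial_apply]

variable {U : Ultrafilter ι} {γ : ι → E} {t : ι → ℂ}

lemma jet_ofPolynomial (hγ : Tendsto γ U (𝓝 0)) (hp : Tendsto (fun x => (t x, γ x)) U (𝓝 0))
    (V : ι → E) (b : ι → ℂ) (R : (holomorphicNear E)[X]) :
    jet U hp (fun x => (b x, V x)) (ofPolynomial R) =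
      eval₂ (jet U hγ V) (TrivSqZeroExt.inl (t : Germ (U : Filter ι) ℂ) +
        TrivSqZeroExt.inr (b : Germ (U : Filter ι) ℂ)) R := by
  rw [ofPolynomial, coe_eval₂RingHom, hom_eval₂, jet_ofLinear]
  congr 1
  ext1 h
  exact jet_comp hp _ _ hγ h

/-- A tangent vector field extends along a Weierstrass projection. -/
theorem exists_isTangent_prod [FiniteDimensional ℂ E] (hγ : Tendsto γ U (𝓝 0))
    (hp : Tendsto (fun x => (t x, γ x)) U (𝓝 0)) {V : ι → E} (hV : IsTangent hγ V)
    (g : holomorphicNear (ℂ × E)) (hg : ∀ᶠ x in (U : Filter ι), g.1 (t x, γ x) = 0)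
    (hg0 : ¬ ∀ᶠ z : ℂ in 𝓝 0, g.1 (z, 0) = 0) :
    ∃ b : ι → ℂ, IsTangent hp (fun x => (b x, V x)) := by
  obtain ⟨m, hdiv⟩ := exists_division g hg0
  obtain ⟨q, r, hqr⟩ := hdiv (ofLinear (ContinuousLinearMap.fst ℂ ℂ E) ^ m)
  let W : (holomorphicNear E)[X] := X ^ m - ∑ j ∈ Finset.range m, C (r j) * X ^ j
  have hW : W.Monic := by
    refine monic_X_pow_sub (mem_degreeLT.1 (Submodule.sum_mem _ fun j hj => mem_degreeLT.2 ?_))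
    exact (degree_C_mul_X_pow_le j _).trans_lt (by exact_mod_cast Finset.mem_range.1 hj)
  have hWg : ∀ᶠ p in 𝓝 0, (ofPolynomial W).1 p = (g * q).1 p := by
    filter_upwards [hqr] with p hp
    rw [map_sub, map_pow]
    change (ofPolynomial (X : (holomorphicNear E)[X])).1 p ^ m - (ofPolynomial _).1 p = _
    rw [ofPolynomial_sum, sub_eq_iff_eq_add]
    refine Eq.trans ?_ hp
    simp only [ofPolynomial_apply, Polynomial.map_X, eval_X]; rfl
  have hWfst : ∀ V', (jet U hp V' (ofPolynomial W)).fst = 0 := by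
    intro V'
    rw [fst_jet_eq_zero_iff]
    filter_upwards [hg, hp.eventually hWg] with x hx hx'
    rw [hx']
    change g.1 _ * q.1 _ = 0
    rw [hx, zero_mul]
  have := charZero_germ U
  obtain ⟨β, hβ⟩ := exists_dualNumber_extension (jet U hγ V) hV (t : Germ (U : Filter ι) ℂ) hW (by
    have := hWfst (fun x => ((0 : ι → ℂ) x, V x))
    rw [jet_ofPolynomial hγ hp V 0] at this
    simpa using this)
  induction β using Germ.inductionOn with | _ b
  refine ⟨b, ?_⟩
  simp only [← jet_ofPolynomial hγ hp V b] at hβ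
  have hW0 : ¬ ∀ᶠ z : ℂ in 𝓝 0, (ofPolynomial W).1 (z, 0) = 0 := by
    intro h0
    simp only [ofPolynomial_apply] at h0
    have hne := (hW.map ((Pi.evalRingHom (fun _ : E => ℂ) 0).comp
      (holomorphicNear E).subtype)).ne_zero
    exact infinite_of_mem_nhds (0 : ℂ) h0 (finite_setOfPred_isRoot hne)
  obtain ⟨k, hdivW⟩ := exists_division (ofPolynomial W) hW0
  intro h hh
  obtain ⟨q', r', hqr'⟩ := hdivW h
  have heq : jet U hp (fun x => (b x, V x)) h =
      jet U hp (fun x => (b x, V x))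
        (ofPolynomial (∑ j ∈ Finset.range k, C (r' j) * X ^ j)) := by
    rw [jet_congr hp _ (k := ofPolynomial W * q' +
      ofPolynomial (∑ j ∈ Finset.range k, C (r' j) * X ^ j)), map_add, map_mul, hβ W (hWfst _),
      zero_mul, zero_add]
    filter_upwards [hqr'] with p hp
    rw [hp, ← ofPolynomial_sum]; rfl
  rw [heq] at hh ⊢
  exact hβ _ hh

end holomorphicNear

namespace holomorphicNear

universe u

variable {E : Type u} [NormedAddCommGroup E] [NormedSpace ℂ E] [FiniteDimensional ℂ E]

/-- A holomorphic function vanishing on a hyperplane is divisible by the equation of this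
hyperplane. -/
lemma exists_eq_mul_of_eq_zero_on_ker (ℓ : E →L[ℂ] ℂ) {v : E} (hv : ℓ v = 1)
    (g : holomorphicNear E) (hg : ∀ᶠ y : ℓ.ker in 𝓝 0, g.1 y = 0) :
    ∃ q : holomorphicNear E, ∀ᶠ x in 𝓝 0, g.1 x = ℓ x * q.1 x := by
  let e : E ≃L[ℂ] ℂ × ℓ.ker := ContinuousLinearEquiv.equivOfRightInverse ℓ
    (ContinuousLinearMap.toSpanSingleton ℂ v) fun z => by simp [hv]
  obtain ⟨q, r, hq, -, hqr⟩ := exists_weierstrass_division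
    (ofLinear (ContinuousLinearMap.fst ℂ ℂ ℓ.ker)).2 (m := 1) (u := fun _ => 1)
    analyticAt_const one_ne_zero (Eventually.of_forall fun z => by simp [ofLinear])
    (comp (e.symm : ℂ × ℓ.ker →L[ℂ] E) g).2
  have hr : ∀ᶠ y in 𝓝 0, r 0 y = 0 := by
    have ht : Tendsto (fun y : ℓ.ker => ((0 : ℂ), y)) (𝓝 0) (𝓝 0) :=
      Continuous.tendsto' (by fun_prop) _ _ rfl
    filter_upwards [hg, ht.eventually hqr] with y hy hy'
    simpa [e, hy, ofLinear] using hy'.symm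
  refine ⟨comp (e : E →L[ℂ] ℂ × ℓ.ker) ⟨q, hq⟩, ?_⟩
  have ht : Tendsto e (𝓝 0) (𝓝 0) := e.continuous.tendsto' _ _ (map_zero e)
  filter_upwards [ht.eventually hqr, (continuous_snd.tendsto' 0 0 rfl).comp ht |>.eventually hr]
    with x hx hx'
  have hx'' : r 0 (e x).2 = 0 := hx'
  have he : (e x).1 = ℓ x := rfl
  simpa [hx'', ofLinear, he] using hx

variable {ι : Type*} {U : Ultrafilter ι} {γ : ι → E}

/-- Given a nonzero holomorphic function vanishing along `γ`, there is one which does not vanish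
identically on the hyperplane `ℓ = 0`. -/
lemma exists_not_eventually_eq_zero_on_ker (hγ : Tendsto γ U (𝓝 0)) (ℓ : E →L[ℂ] ℂ)
    (hℓ : ∀ᶠ x in (U : Filter ι), ℓ (γ x) ≠ 0) (g : holomorphicNear E)
    (hgγ : ∀ᶠ x in (U : Filter ι), g.1 (γ x) = 0) (hg : ¬ ∀ᶠ x in 𝓝 0, g.1 x = 0) :
    ∃ g' : holomorphicNear E, (∀ᶠ x in (U : Filter ι), g'.1 (γ x) = 0) ∧
      ∃ w, ℓ w = 0 ∧ ¬ ∀ᶠ z : ℂ in 𝓝 0, g'.1 (z • w) = 0 := by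
  obtain ⟨w₀, hw₀⟩ : ∃ w, ¬ ∀ᶠ z : ℂ in 𝓝 0, g.1 (z • w) = 0 := by
    by_contra! h
    exact hg (eventually_eq_zero_of_lines g h)
  obtain ⟨x₀, hx₀⟩ := hℓ.exists
  have hv : ℓ ((ℓ (γ x₀))⁻¹ • γ x₀) = 1 := by simp [hx₀]
  have key : ∀ N : ℕ, ∀ g : holomorphicNear E, (∀ᶠ x in (U : Filter ι), g.1 (γ x) = 0) →
      analyticOrderAt (fun z : ℂ => g.1 (z • w₀)) 0 < N →
      ∃ g' : holomorphicNear E, (∀ᶠ x in (U : Filter ι), g'.1 (γ x) = 0) ∧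
        ∃ w, ℓ w = 0 ∧ ¬ ∀ᶠ z : ℂ in 𝓝 0, g'.1 (z • w) = 0 := by
    intro N
    induction N with
    | zero => intro g _ h; simp at h
    | succ N ih =>
      intro g hgγ hN
      by_cases hker : ∃ w, ℓ w = 0 ∧ ¬ ∀ᶠ z : ℂ in 𝓝 0, g.1 (z • w) = 0
      · exact ⟨g, hgγ, hker⟩
      push Not at hker
      obtain ⟨q, hq⟩ := exists_eq_mul_of_eq_zero_on_ker ℓ hv g
        (eventually_eq_zero_of_lines (comp ℓ.ker.subtypeL g) fun w => hker w w.2)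
      refine ih q ?_ ?_
      · filter_upwards [hgγ, hℓ, hγ.eventually hq] with x h₁ h₂ h₃
        rw [h₁] at h₃
        exact (mul_eq_zero.1 h₃.symm).resolve_left h₂
      · have ht : Tendsto (fun z : ℂ => z • w₀) (𝓝 0) (𝓝 0) :=
          Continuous.tendsto' (by fun_prop) _ _ (zero_smul ..)
        have hmul : (fun z : ℂ => g.1 (z • w₀)) =ᶠ[𝓝 0]
            (fun z : ℂ => ℓ (z • w₀)) * fun z : ℂ => q.1 (z • w₀) := ht.eventually hq
        have hℓan : AnalyticAt ℂ (fun z : ℂ => ℓ (z • w₀)) 0 := analyticAt_smul (ofLinear ℓ) w₀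
        rw [analyticOrderAt_congr hmul, analyticOrderAt_mul hℓan (analyticAt_smul q w₀)] at hN
        have h1 : 1 ≤ analyticOrderAt (fun z : ℂ => ℓ (z • w₀)) 0 :=
          Order.one_le_iff_ne_zero.2 (hℓan.analyticOrderAt_ne_zero.2 (by simp))
        by_contra! hle
        refine hN.not_ge ?_
        rw [Nat.cast_add, add_comm (N : ℕ∞), Nat.cast_one]
        exact add_le_add h1 hle
  have hfin : analyticOrderAt (fun z : ℂ => g.1 (z • w₀)) 0 ≠ ⊤ := by
    rwa [Ne, analyticOrderAt_eq_top]
  obtain ⟨N, hN⟩ := ENat.ne_top_iff_exists.1 hfin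
  exact key (N + 1) g hgγ (by rw [← hN]; exact_mod_cast Nat.lt_succ_self N)

variable (U) in
/-- If `γ` tends to the origin off the hyperplane `ℓ = 0`, there is a vector field along `γ` which
is tangent to every hypersurface containing `γ` and transverse to the hyperplane. -/
theorem exists_isTangent (d : ℕ) : ∀ {E : Type u} [NormedAddCommGroup E] [NormedSpace ℂ E]
    [FiniteDimensional ℂ E], Module.finrank ℂ E < d → ∀ (ℓ : E →L[ℂ] ℂ) {γ : ι → E}
    (hγ : Tendsto γ U (𝓝 0)), (∀ᶠ x in (U : Filter ι), ℓ (γ x) ≠ 0) →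
    ∃ V : ι → E, (∀ x, ℓ (V x) = 1) ∧ IsTangent hγ V := by
  induction d with
  | zero => intro E _ _ _ h; simp at h
  | succ d ih =>
    intro E _ _ _ hd ℓ γ hγ hℓ
    by_cases hall : ∀ h : holomorphicNear E, (∀ᶠ x in (U : Filter ι), h.1 (γ x) = 0) →
        ∀ᶠ x in 𝓝 0, h.1 x = 0
    · obtain ⟨x₀, hx₀⟩ := hℓ.exists
      refine ⟨fun _ => (ℓ (γ x₀))⁻¹ • γ x₀, fun _ => by simp [hx₀], fun h hh => ?_⟩
      rw [fst_jet_eq_zero_iff] at hh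
      rw [jet_congr hγ _ (k := 0) (hall h hh), map_zero]
    push Not at hall
    obtain ⟨g₀, hg₀γ, hg₀⟩ := hall
    obtain ⟨g, hgγ, w, hw, hg⟩ := exists_not_eventually_eq_zero_on_ker hγ ℓ hℓ g₀ hg₀γ
      (not_eventually.2 hg₀)
    have hw0 : w ≠ 0 := by
      rintro rfl
      have hg0 : Tendsto (fun x => g.1 (γ x)) U (𝓝 (g.1 0)) :=
        g.2.self_of_nhds.continuousAt.tendsto.comp hγ
      refine hg (Eventually.of_forall fun z => ?_)
      rw [smul_zero]
      exact tendsto_nhds_unique hg0 (tendsto_const_nhds.congr' (hgγ.mono fun x hx => hx.symm))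
    obtain ⟨φ, hφ⟩ := SeparatingDual.exists_eq_one (R := ℂ) hw0
    let e : E ≃L[ℂ] ℂ × φ.ker := ContinuousLinearEquiv.equivOfRightInverse φ
      (ContinuousLinearMap.toSpanSingleton ℂ w) fun z => by simp [hφ]
    have he : ∀ p, e.symm p = p.1 • w + p.2 := fun p => rfl
    have hp : Tendsto (fun x => e (γ x)) U (𝓝 0) :=
      (e.continuous.tendsto' 0 0 (map_zero e)).comp hγ
    have hγ' : Tendsto (fun x => (e (γ x)).2) U (𝓝 0) := (continuous_snd.tendsto' 0 0 rfl).comp hp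
    have hlt : Module.finrank ℂ φ.ker < Module.finrank ℂ E :=
      Submodule.finrank_lt fun htop => one_ne_zero (α := ℂ) <| by
        rw [← hφ]; exact (htop ▸ Submodule.mem_top : w ∈ φ.ker)
    have hℓe : ∀ x, ℓ (γ x) = ℓ (e (γ x)).2 := fun x => by
      conv_lhs => rw [← e.symm_apply_apply (γ x), he]
      simp [hw]
    obtain ⟨V, hV1, hV⟩ := ih (hlt.trans_le (Nat.lt_succ_iff.1 hd)) (ℓ.comp φ.ker.subtypeL) hγ'
      (hℓ.mono fun x hx => by rwa [hℓe] at hx)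
    obtain ⟨b, hb⟩ := exists_isTangent_prod hγ' (t := fun x => (e (γ x)).1) hp hV
      (comp (e.symm : ℂ × φ.ker →L[ℂ] E) g) (hgγ.mono fun x hx => by
        simpa using hx) (by simpa [he] using hg)
    refine ⟨fun x => e.symm (b x, V x), fun x => ?_, fun h hh => ?_⟩
    · change ℓ (e.symm (b x, V x)) = 1
      rw [he, map_add, map_smul, hw, smul_zero, zero_add]
      exact hV1 x
    · have hcomp : h = comp (e : E →L[ℂ] ℂ × φ.ker) (comp (e.symm : ℂ × φ.ker →L[ℂ] E) h) :=
        Subtype.ext (funext fun x => by simp)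
      have hjet : jet U hγ (fun x => e.symm (b x, V x)) h =
          jet U hp (fun x => (b x, V x)) (comp (e.symm : ℂ × φ.ker →L[ℂ] E) h) := by
        conv_lhs => rw [hcomp]
        rw [jet_comp hγ _ (e : E →L[ℂ] ℂ × φ.ker) hp]
        simp
      rw [hjet] at hh ⊢
      exact hb _ hh

/-- A holomorphic function is constant on the critical points near the origin. -/
theorem eventually_eq_of_fderiv_eq_zero (f : holomorphicNear E) :
    ∀ᶠ y in 𝓝 0, fderiv ℂ f.1 y = 0 → f.1 y = f.1 0 := by
  by_contra hne
  let S : Set E := {y | fderiv ℂ f.1 y = 0 ∧ f.1 y ≠ f.1 0}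
  have hS : (𝓝 0 ⊓ 𝓟 S).NeBot := by
    rw [← frequently_mem_iff_neBot]
    refine (not_eventually.1 hne).mono fun y hy => ?_
    simpa [S] using hy
  let U : Ultrafilter E := Ultrafilter.of (𝓝 0 ⊓ 𝓟 S)
  have hU0 : Tendsto id (U : Filter E) (𝓝 0) := (Ultrafilter.of_le _).trans inf_le_left
  have hUS : ∀ᶠ y in (U : Filter E), y ∈ S :=
    le_principal_iff.1 ((Ultrafilter.of_le _).trans inf_le_right)
  have hγ : Tendsto (fun y => (f.1 y - f.1 0, y)) (U : Filter E) (𝓝 0) := by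
    refine Tendsto.prodMk_nhds ?_ hU0
    simpa using (f.2.self_of_nhds.continuousAt.tendsto.comp hU0).sub_const (f.1 0)
  obtain ⟨V, hV1, hV⟩ := exists_isTangent U _ (Nat.lt_succ_self _)
    (ContinuousLinearMap.fst ℂ ℂ E) hγ (hUS.mono fun y hy => by simpa [sub_eq_zero] using hy.2)
  let c : holomorphicNear E := ⟨fun _ => f.1 0, Eventually.of_forall fun _ => by fun_prop⟩
  let h : holomorphicNear (ℂ × E) := comp (ContinuousLinearMap.snd ℂ ℂ E) (f - c) -
    ofLinear (ContinuousLinearMap.fst ℂ ℂ E)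
  have hzero := hV h ((fst_jet_eq_zero_iff hγ V h).2 (Eventually.of_forall fun y => sub_self _))
  have hsnd := (snd_jet_eq_zero_iff hγ V h).1 (by rw [hzero]; rfl)
  obtain ⟨y, hy, hyS, hyf⟩ := (hsnd.and (hUS.and (hU0.eventually f.2))).exists
  have hd : HasFDerivAt h.1 (((0 : E →L[ℂ] ℂ).comp (ContinuousLinearMap.snd ℂ ℂ E)) -
      ContinuousLinearMap.fst ℂ ℂ E) (f.1 y - f.1 0, y) := by
    have hfy : HasFDerivAt f.1 (0 : E →L[ℂ] ℂ) y := hyS.1 ▸ hyf.hasFDerivAt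
    exact ((hfy.sub_const (f.1 0)).comp (f.1 y - f.1 0, y)
      (ContinuousLinearMap.snd ℂ ℂ E).hasFDerivAt).sub
      (ContinuousLinearMap.fst ℂ ℂ E).hasFDerivAt
  rw [hd.fderiv] at hy
  have := hV1 y
  simp_all

end holomorphicNear

theorem image_of_compact_rank_zero_finite
    {N n : ℕ} (Ω : Set (Fin N → ℂ)) (hΩ : IsOpen Ω)
    (f : (Fin N → ℂ) → (Fin n → ℂ)) (hf : DifferentiableOn ℂ f Ω)
    (K : Set (Fin N → ℂ)) (hK : IsCompact K) (hKΩ : K ⊆ Ω)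
    (hrk : ∀ y ∈ K, fderiv ℂ f y = 0) :
    (f '' K).Finite := by
  have hloc : ∀ p ∈ K, ∀ᶠ y in 𝓝 p, y ∈ K → f y = f p := by
    intro p hp
    have hdiff : ∀ᶠ y in 𝓝 p, DifferentiableAt ℂ f y :=
      (hΩ.eventually_mem (hKΩ hp)).mono fun y hy => hf.differentiableAt (hΩ.mem_nhds hy)
    have hcoord : ∀ i, ∀ᶠ y in 𝓝 p, y ∈ K → f y i = f p i := by
      intro i
      have ht : Tendsto (fun y => y + p) (𝓝 0) (𝓝 p) :=
        Continuous.tendsto' (by fun_prop) _ _ (zero_add p)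
      let g : holomorphicNear (Fin N → ℂ) := ⟨fun y => f (y + p) i, by
        filter_upwards [ht.eventually hdiff] with y hy
        exact (differentiableAt_comp_add_right (f := fun z => f z i) p).2
          (differentiableAt_pi.1 hy i)⟩
      have ht' : Tendsto (fun y => y - p) (𝓝 p) (𝓝 0) :=
        Continuous.tendsto' (by fun_prop) _ _ (sub_self p)
      filter_upwards [ht'.eventually (holomorphicNear.eventually_eq_of_fderiv_eq_zero g), hdiff]
        with y hy hfy hyK
      have hfi : HasFDerivAt (fun y => f y i) (0 : (Fin N → ℂ) →L[ℂ] ℂ) y := by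
        have := hasFDerivAt_pi'.1 (hrk y hyK ▸ hfy.hasFDerivAt) i
        simpa using this
      have hgd : fderiv ℂ g.1 (y - p) = 0 :=
        (fderiv_comp_add_right (f := fun z => f z i) p).trans
          (by rw [sub_add_cancel]; exact hfi.fderiv)
      simpa [g] using hy hgd
    filter_upwards [eventually_all.2 hcoord] with y hy hyK
    exact funext fun i => hy i hyK
  obtain ⟨t, ht⟩ := hK.elim_nhds_subcover' (fun p _ => {y | y ∈ K → f y = f p}) hloc
  refine (t.finite_toSet.image fun p : K => f p).subset ?_
  rintro _ ⟨y, hy, rfl⟩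
  obtain ⟨p, hpt, hyp⟩ := Set.mem_iUnion₂.1 (ht hy)
  exact ⟨p, hpt, (hyp hy).symm⟩
end

section
/- Let u₁, u₂, u₃ : ℂ → ℂ be entire functions (holomorphic on all of ℂ) that are algebraically independent over ℂ, and define f : ℂ² → ℂ³ by f(z,w) = (u₁(z)·w, u₂(z)·w, u₃(z)·w). Suppose g is a holomorphic function on an open neighborhood of 0 in ℂ³ such that the composition g ∘ f vanishes identically on some open neighborhood of 0 in ℂ². Then g vanishes identically on some open neighborhood of 0 in ℂ³. -/
/-- The value at `x` of the degree `n` homogeneous part of the expansion of `g` at `0`. -/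
noncomputable def homogeneousPart {E : Type*} [NormedAddCommGroup E] [NormedSpace ℂ E]
    (g : E → ℂ) (n : ℕ) (x : E) : ℂ :=
  (n.factorial : ℂ)⁻¹ * iteratedDeriv n (fun t : ℂ => g (t • x)) 0

theorem norm_taylorCoeff_le {φ : ℂ → ℂ} {r M : ℝ} (hr : 0 < r)
    (hφ : DifferentiableOn ℂ φ (Metric.closedBall 0 r))
    (hM : ∀ t ∈ Metric.closedBall (0 : ℂ) r, ‖φ t‖ ≤ M) (n : ℕ) :
    ‖(n.factorial : ℂ)⁻¹ * iteratedDeriv n φ 0‖ ≤ M / r ^ n := by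
  have h := Complex.norm_iteratedDeriv_le_of_forall_mem_sphere_norm_le n hr
    (hφ.diffContOnCl_ball subset_rfl)
    (fun z hz => hM z (Metric.sphere_subset_closedBall hz))
  have hn : (0 : ℝ) < n.factorial := by exact_mod_cast n.factorial_pos
  rw [norm_mul, norm_inv, Complex.norm_natCast, inv_mul_le_iff₀ hn]
  exact h.trans_eq (by ring)

theorem norm_sub_taylorCoeff_mul_pow_le {φ : ℂ → ℂ} {r M : ℝ} (hr : 0 < r)
    (hφ : DifferentiableOn ℂ φ (Metric.closedBall 0 r))
    (hM : ∀ t ∈ Metric.closedBall (0 : ℂ) r, ‖φ t‖ ≤ M) {n : ℕ}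
    (hz : ∀ k < n, iteratedDeriv k φ 0 = 0) {t : ℂ} (ht : ‖t‖ ≤ r / 2) :
    ‖φ t - (n.factorial : ℂ)⁻¹ * iteratedDeriv n φ 0 * t ^ n‖ ≤ 2 * M * (‖t‖ / r) ^ (n + 1) := by
  have hM0 : 0 ≤ M := (norm_nonneg _).trans (hM 0 (by simp [hr.le]))
  have hq0 : 0 ≤ ‖t‖ / r := by positivity
  have hq : ‖t‖ / r ≤ 1 / 2 := by rw [div_le_iff₀ hr]; linarith
  have hsum := Complex.hasSum_taylorSeries_on_ball (hφ.mono Metric.ball_subset_closedBall)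
    (z := t) (by rw [mem_ball_zero_iff]; linarith)
  have hsum' := (hasSum_nat_add_iff' (n + 1)).2 hsum
  have hfin : ∑ i ∈ Finset.range (n + 1),
      ((i.factorial : ℂ)⁻¹ • (t - 0) ^ i • iteratedDeriv i φ 0) =
      (n.factorial : ℂ)⁻¹ * iteratedDeriv n φ 0 * t ^ n := by
    rw [Finset.sum_range_succ, Finset.sum_eq_zero]
    · simp only [sub_zero, smul_eq_mul, zero_add]; ring
    · intro k hk
      simp [hz k (Finset.mem_range.1 hk)]
  rw [hfin] at hsum'
  have hgeom := (hasSum_geometric_of_lt_one hq0 (by linarith)).mul_left (M * (‖t‖ / r) ^ (n + 1))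
  refine (hsum'.norm_le_of_bounded hgeom fun k => ?_).trans ?_
  · have h := norm_taylorCoeff_le hr hφ hM (k + (n + 1))
    calc _ = ‖((k + (n + 1)).factorial : ℂ)⁻¹ * iteratedDeriv (k + (n + 1)) φ 0‖ *
            ‖t‖ ^ (k + (n + 1)) := by
          rw [← norm_pow, ← norm_mul]; congr 1; simp only [sub_zero, smul_eq_mul]; ring
      _ ≤ M / r ^ (k + (n + 1)) * ‖t‖ ^ (k + (n + 1)) := by gcongr
      _ = _ := by rw [mul_assoc, ← pow_add, div_pow, add_comm (n + 1) k]; ring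
  · have : (1 - ‖t‖ / r)⁻¹ ≤ 2 := by
      rw [inv_le_comm₀ (by linarith) (by norm_num)]; linarith
    calc _ ≤ M * (‖t‖ / r) ^ (n + 1) * 2 := by gcongr
      _ = _ := by ring

section HomogeneousPart

variable {E : Type*} [NormedAddCommGroup E] [NormedSpace ℂ E] {g : E → ℂ} {R M : ℝ}

theorem smul_mem_ball_of_mul_le {r ρ : ℝ} (hr : 0 < r) (hrρ : r * ρ ≤ R) {x : E} (hx : ‖x‖ < ρ)
    {t : ℂ} (ht : t ∈ Metric.closedBall (0 : ℂ) r) : t • x ∈ Metric.ball (0 : E) R := by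
  rw [mem_closedBall_zero_iff] at ht
  rw [mem_ball_zero_iff, norm_smul]
  calc ‖t‖ * ‖x‖ ≤ r * ‖x‖ := by gcongr
    _ < r * ρ := by gcongr
    _ ≤ R := hrρ

theorem differentiableOn_comp_smul (hg : DifferentiableOn ℂ g (Metric.ball 0 R))
    {r ρ : ℝ} (hr : 0 < r) (hrρ : r * ρ ≤ R) {x : E} (hx : ‖x‖ < ρ) :
    DifferentiableOn ℂ (fun t : ℂ => g (t • x)) (Metric.closedBall 0 r) :=
  hg.comp (by fun_prop) fun _ ht => smul_mem_ball_of_mul_le hr hrρ hx ht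

theorem norm_homogeneousPart_le (hR : 0 < R) (hg : DifferentiableOn ℂ g (Metric.ball 0 R))
    (hM : ∀ x ∈ Metric.ball (0 : E) R, ‖g x‖ ≤ M) (n : ℕ) (x : E) :
    ‖homogeneousPart g n x‖ ≤ M / R ^ n * (‖x‖ + 1) ^ n := by
  have hρ : 0 < ‖x‖ + 1 := by positivity
  have hrρ : R / (‖x‖ + 1) * (‖x‖ + 1) ≤ R := by rw [div_mul_cancel₀ _ hρ.ne']
  have hx : ‖x‖ < ‖x‖ + 1 := by linarith
  refine (norm_taylorCoeff_le (div_pos hR hρ)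
    (differentiableOn_comp_smul hg (div_pos hR hρ) hrρ hx)
    (fun t ht => hM _ (smul_mem_ball_of_mul_le (div_pos hR hρ) hrρ hx ht)) n).trans_eq ?_
  rw [div_pow]
  field_simp

theorem eq_zero_of_homogeneousPart_eq_zero (hg : DifferentiableOn ℂ g (Metric.ball 0 R))
    (h0 : ∀ n x, homogeneousPart g n x = 0) {x : E} (hx : x ∈ Metric.ball (0 : E) R) :
    g x = 0 := by
  rw [mem_ball_zero_iff] at hx
  obtain ⟨ρ, hxρ, hρR⟩ := exists_between hx
  have hρ : 0 < ρ := (norm_nonneg x).trans_lt hxρ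
  have hrρ : R / ρ * ρ ≤ R := by rw [div_mul_cancel₀ _ hρ.ne']
  have hsum := Complex.hasSum_taylorSeries_on_ball (z := (1 : ℂ))
    ((differentiableOn_comp_smul hg (div_pos (hρ.trans hρR) hρ) hrρ hxρ).mono
      Metric.ball_subset_closedBall)
    (by rw [mem_ball_zero_iff, norm_one]; exact (one_lt_div hρ).2 hρR)
  simp only [one_smul] at hsum
  refine hsum.unique (HasSum.congr_fun hasSum_zero fun n => ?_)
  simpa [homogeneousPart] using h0 n x

/-- The first nonvanishing homogeneous part of `g` is the locally uniform limit of
`x ↦ g (t • x) / t ^ n` as `t → 0`, hence is holomorphic along holomorphic curves. -/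
theorem differentiable_homogeneousPart_comp (hR : 0 < R)
    (hg : DifferentiableOn ℂ g (Metric.ball 0 R))
    (hM : ∀ x ∈ Metric.ball (0 : E) R, ‖g x‖ ≤ M) {n : ℕ}
    (hz : ∀ k < n, ∀ x, homogeneousPart g k x = 0) {γ : ℂ → E} (hγ : Differentiable ℂ γ) :
    Differentiable ℂ fun s => homogeneousPart g n (γ s) := by
  intro s₀
  have hM0 : 0 ≤ M := (norm_nonneg _).trans (hM 0 (by simp [hR]))
  set ρ := ‖γ s₀‖ + 1
  have hρ : 0 < ρ := by positivity
  set r := R / ρ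
  have hr : 0 < r := div_pos hR hρ
  have hrρ : r * ρ ≤ R := by rw [div_mul_cancel₀ _ hρ.ne']
  set U : Set ℂ := γ ⁻¹' Metric.ball 0 ρ
  have hU : IsOpen U := Metric.isOpen_ball.preimage hγ.continuous
  have hs₀ : s₀ ∈ U := by simp [U, ρ]
  have hUρ : ∀ s ∈ U, ‖γ s‖ < ρ := fun s hs => mem_ball_zero_iff.1 hs
  have hsmall : ∀ᶠ t : ℂ in nhdsWithin 0 {0}ᶜ, ‖t‖ ≤ r / 2 ∧ t ≠ 0 := by
    refine Filter.Eventually.and (nhdsWithin_le_nhds ?_) self_mem_nhdsWithin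
    filter_upwards [Metric.closedBall_mem_nhds (0 : ℂ) (half_pos hr)] with t ht
    exact mem_closedBall_zero_iff.1 ht
  have hlim : TendstoUniformlyOn (fun t s => g (t • γ s) / t ^ n)
      (fun s => homogeneousPart g n (γ s)) (nhdsWithin (0 : ℂ) {0}ᶜ) U := by
    rw [Metric.tendstoUniformlyOn_iff]
    intro ε hε
    have hC : ∀ᶠ t : ℂ in nhdsWithin 0 {0}ᶜ, 2 * M / r ^ (n + 1) * ‖t‖ < ε := by
      refine nhdsWithin_le_nhds ?_
      have hcont : Continuous fun t : ℂ => 2 * M / r ^ (n + 1) * ‖t‖ := by fun_prop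
      exact hcont.continuousAt.eventually_lt continuousAt_const (by simpa using hε)
    filter_upwards [hsmall, hC] with t ⟨ht, ht0⟩ htε s hs
    have h := norm_sub_taylorCoeff_mul_pow_le hr
      (differentiableOn_comp_smul hg hr hrρ (hUρ s hs))
      (fun t ht => hM _ (smul_mem_ball_of_mul_le hr hrρ (hUρ s hs) ht)) (n := n)
      (fun k hk => by
        simpa [homogeneousPart, Nat.factorial_ne_zero] using hz k hk (γ s)) ht
    have htn : 0 < ‖t‖ ^ n := pow_pos (norm_pos_iff.2 ht0) n
    refine lt_of_le_of_lt ?_ htε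
    rw [dist_comm, dist_eq_norm]
    have heq : g (t • γ s) / t ^ n - homogeneousPart g n (γ s) =
        (g (t • γ s) - homogeneousPart g n (γ s) * t ^ n) / t ^ n := by
      field_simp
    rw [heq, norm_div, norm_pow, div_le_iff₀ htn]
    refine h.trans_eq ?_
    rw [div_pow]
    ring
  refine (hlim.tendstoLocallyUniformlyOn.differentiableOn ?_ hU).differentiableAt
    (hU.mem_nhds hs₀)
  filter_upwards [hsmall] with t ht
  refine DifferentiableOn.div_const (hg.comp (by fun_prop) fun s hs => ?_) _
  refine smul_mem_ball_of_mul_le hr hrρ (hUρ s hs) (mem_closedBall_zero_iff.2 ?_)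
  linarith [ht.1]

end HomogeneousPart

/-- An entire function of polynomial growth is a polynomial. -/
theorem exists_polynomial_of_norm_le {f : ℂ → ℂ} (hf : Differentiable ℂ f) {C A : ℝ} {n : ℕ}
    (hA : 0 ≤ A) (hC : ∀ s, ‖f s‖ ≤ C * (‖s‖ + A) ^ n) :
    ∃ q : Polynomial ℂ, q.degree < (n + 1 : ℕ) ∧ ∀ s, f s = q.eval s := by
  have hzero : ∀ k, n < k → iteratedDeriv k f 0 = 0 := by
    intro k hk
    have hC0 : 0 ≤ C := by
      by_contra! hneg
      have h1 := (norm_nonneg _).trans (hC 1)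
      have : 0 < (‖(1 : ℂ)‖ + A) ^ n := by rw [norm_one]; positivity
      nlinarith
    have hbound : ∀ ρ : ℝ, 0 < ρ → A ≤ ρ →
        ‖iteratedDeriv k f 0‖ ≤ k.factorial * C * 2 ^ n * ρ⁻¹ ^ (k - n) := by
      intro ρ hρ hAρ
      refine (Complex.norm_iteratedDeriv_le_of_forall_mem_sphere_norm_le
        (C := C * (2 * ρ) ^ n) k hρ hf.diffContOnCl fun z hz => ?_).trans_eq ?_
      · rw [mem_sphere_zero_iff_norm] at hz
        refine (hC z).trans ?_
        rw [hz]
        gcongr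
        linarith
      · obtain ⟨m, rfl⟩ := Nat.exists_eq_add_of_lt hk
        rw [show n + m + 1 - n = m + 1 by omega, mul_pow, inv_pow]
        field_simp
        ring
    have hlim : Filter.Tendsto (fun ρ : ℝ => k.factorial * C * 2 ^ n * ρ⁻¹ ^ (k - n))
        Filter.atTop (nhds 0) := by
      have := (tendsto_inv_atTop_zero (𝕜 := ℝ)).pow (k - n)
      rw [zero_pow (by omega)] at this
      simpa using this.const_mul (k.factorial * C * 2 ^ n)
    have := ge_of_tendsto hlim (b := ‖iteratedDeriv k f 0‖) (by
      filter_upwards [Filter.eventually_gt_atTop 0, Filter.eventually_ge_atTop A] with ρ h1 h2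
      exact hbound ρ h1 h2)
    exact norm_le_zero_iff.1 this
  refine ⟨∑ k ∈ Finset.range (n + 1),
    Polynomial.monomial k ((k.factorial : ℂ)⁻¹ * iteratedDeriv k f 0), ?_, fun s => ?_⟩
  · refine (Polynomial.degree_sum_le _ _).trans_lt ((Finset.sup_lt_iff (WithBot.bot_lt_coe _)).2 ?_)
    intro k hk
    exact (Polynomial.degree_monomial_le _ _).trans_lt
      (by exact_mod_cast Finset.mem_range.1 hk)
  · have hsum := Complex.hasSum_taylorSeries_of_entire hf 0 s
    rw [← hsum.tsum_eq, tsum_eq_sum (s := Finset.range (n + 1)), Polynomial.eval_finsetSum]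
    · refine Finset.sum_congr rfl fun k _ => ?_
      simp only [sub_zero, smul_eq_mul, Polynomial.eval_monomial]
      ring
    · intro k hk
      simp [hzero k (by simpa using hk)]

/-- A function which is a polynomial of bounded degree in each variable is a polynomial. -/
theorem exists_mvPolynomial_of_separately {σ : Type*} [Fintype σ] [DecidableEq σ]
    {F : (σ → ℂ) → ℂ} {d : ℕ}
    (hF : ∀ x i, ∃ q : Polynomial ℂ, q.degree < d ∧
      ∀ s, F (Function.update x i s) = q.eval s) :
    ∃ P : MvPolynomial σ ℂ, ∀ x, F x = MvPolynomial.eval x P := by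
  have key : ∀ (S : Finset σ) (c : σ → ℂ), ∃ P : MvPolynomial σ ℂ,
      ∀ x, (∀ i ∉ S, x i = c i) → F x = MvPolynomial.eval x P := by
    intro S
    induction S using Finset.induction_on with
    | empty =>
      intro c
      refine ⟨MvPolynomial.C (F c), fun x hx => ?_⟩
      rw [MvPolynomial.eval_C, show x = c from funext fun i => hx i (by simp)]
    | insert i S _ ih =>
      intro c
      choose P hP using fun j : ℕ => ih (Function.update c i (j : ℂ))
      refine ⟨∑ j ∈ Finset.range d,
        MvPolynomial.aeval (Function.update MvPolynomial.X i (MvPolynomial.C (j : ℂ))) (P j) *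
          Polynomial.aeval (MvPolynomial.X i)
            (Lagrange.basis (Finset.range d) (fun j : ℕ => (j : ℂ)) j), fun x hx => ?_⟩
      obtain ⟨q, hq, hqF⟩ := hF x i
      have hinterp := Lagrange.eq_interpolate (s := Finset.range d) (v := fun j : ℕ => (j : ℂ))
        (Nat.cast_injective.injOn) (f := q) (by simpa using hq)
      have hx' : F x = q.eval (x i) := by rw [← hqF, Function.update_eq_self]
      rw [hx', hinterp, Lagrange.interpolate_apply, Polynomial.eval_finsetSum, map_sum]
      refine Finset.sum_congr rfl fun j _ => ?_
      rw [Polynomial.eval_mul, Polynomial.eval_C, map_mul, ← hqF,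
        hP j (Function.update x i (j : ℂ))]
      · congr 1
        · simp only [← MvPolynomial.coe_aeval_eq_eval, RingHom.coe_coe]
          rw [MvPolynomial.comp_aeval_apply]
          congr 2
          funext k
          by_cases hki : k = i
          · subst hki; simp
          · simp [hki]
        · rw [← MvPolynomial.coe_aeval_eq_eval, RingHom.coe_coe, ← Polynomial.aeval_algHom_apply,
            MvPolynomial.aeval_X, Polynomial.coe_aeval_eq_eval]
      · intro k hk
        by_cases hki : k = i
        · subst hki; simp
        · simp [hki, hx k (by simp [hki, hk])]
  obtain ⟨P, hP⟩ := key Finset.univ 0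
  exact ⟨P, fun x => hP x (by simp)⟩

theorem osgood_image_not_in_hypersurface
    (u : Fin 3 → ℂ → ℂ) (hu : ∀ i, Differentiable ℂ (u i))
    (hind : ∀ P : MvPolynomial (Fin 3) ℂ,
      (∀ z : ℂ, MvPolynomial.eval (fun i => u i z) P = 0) → P = 0)
    (Ωg : Set (Fin 3 → ℂ)) (hΩg : IsOpen Ωg) (h0g : (0 : Fin 3 → ℂ) ∈ Ωg)
    (g : (Fin 3 → ℂ) → ℂ) (hg : DifferentiableOn ℂ g Ωg)
    (Ω₂ : Set (ℂ × ℂ)) (hΩ₂ : IsOpen Ω₂) (h0₂ : ((0 : ℂ), (0 : ℂ)) ∈ Ω₂)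
    (hmaps : ∀ p ∈ Ω₂, (fun i : Fin 3 => u i p.1 * p.2) ∈ Ωg)
    (hcomp : ∀ p ∈ Ω₂, g (fun i : Fin 3 => u i p.1 * p.2) = 0) :
    ∃ U : Set (Fin 3 → ℂ), IsOpen U ∧ (0 : Fin 3 → ℂ) ∈ U ∧ ∀ x ∈ U, g x = 0 := by
  have hcont : ContinuousAt g 0 := (hg.differentiableAt (hΩg.mem_nhds h0g)).continuousAt
  have hbdd : ∀ᶠ x in nhds (0 : Fin 3 → ℂ), ‖g x‖ < ‖g 0‖ + 1 :=
    hcont.norm.eventually_lt continuousAt_const (by simp)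
  obtain ⟨R, hR, hball⟩ := Metric.eventually_nhds_iff_ball.1 (hbdd.and (hΩg.mem_nhds h0g))
  have hgR : DifferentiableOn ℂ g (Metric.ball 0 R) := hg.mono fun x hx => (hball x hx).2
  have hM : ∀ x ∈ Metric.ball (0 : Fin 3 → ℂ) R, ‖g x‖ ≤ ‖g 0‖ + 1 :=
    fun x hx => (hball x hx).1.le
  have hcurve : ∀ n, ∀ᶠ z in nhds (0 : ℂ), homogeneousPart g n (fun i => u i z) = 0 := by
    intro n
    filter_upwards [(continuous_id.prodMk continuous_const).continuousAt.preimage_mem_nhds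
      (hΩ₂.mem_nhds h0₂)] with z hz
    have hline : (fun t : ℂ => g (t • fun i => u i z)) =ᶠ[nhds 0] fun _ => 0 := by
      filter_upwards [(Continuous.prodMk_right z).continuousAt.preimage_mem_nhds
        (hΩ₂.mem_nhds hz)] with t ht
      rw [← hcomp _ ht]
      congr 1
      funext i
      simp [mul_comm]
    rw [homogeneousPart, hline.iteratedDeriv_eq, iteratedDeriv_const]
    simp
  refine ⟨Metric.ball 0 R, Metric.isOpen_ball, Metric.mem_ball_self hR, fun x hx =>
    eq_zero_of_homogeneousPart_eq_zero hgR (fun n => ?_) hx⟩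
  induction n using Nat.strong_induction_on with
  | _ n ih =>
  obtain ⟨P, hP⟩ := exists_mvPolynomial_of_separately (F := homogeneousPart g n) (d := n + 1) (by
    intro x i
    refine exists_polynomial_of_norm_le (C := (‖g 0‖ + 1) / R ^ n) (A := ‖x‖ + 1)
      (differentiable_homogeneousPart_comp hR hgR hM ih
        (γ := fun s => Function.update x i s) ?_) (by positivity) fun s => ?_
    · exact fun s => (hasFDerivAt_update x s).differentiableAt
    · refine (norm_homogeneousPart_le hR hgR hM n _).trans ?_
      rw [← add_assoc]
      gcongr
      refine (pi_norm_le_iff_of_nonneg (by positivity)).2 fun j => ?_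
      by_cases hj : j = i
      · subst hj; simp
      · simpa [hj] using (norm_le_pi_norm x j).trans (by simp))
  have hP0 : P = 0 := by
    refine hind P fun z => ?_
    have hana : AnalyticOnNhd ℂ (fun z => MvPolynomial.eval (fun i => u i z) P) Set.univ :=
      fun z _ => AnalyticAt.aeval_mvPolynomial (fun i => (hu i).analyticAt z) P
    refine hana.eqOn_zero_of_preconnected_of_eventuallyEq_zero isPreconnected_univ
      (Set.mem_univ 0) ?_ (Set.mem_univ z)
    filter_upwards [hcurve n] with z hz
    rw [← hP, hz, Pi.zero_apply]
  intro x
  rw [hP, hP0, map_zero]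
end
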